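/- arXiv:2209.01910 — 4 statements merged into one kernel-verified Lean document; each statement's English description precedes it below -/
import Mathlib

section
/- Gaussian location–scale mixture representation of the asymmetric Laplace density: let τ ∈ (0,1), σ > 0, μ ∈ ℝ, and set θ₁ = (1−2τ)/(τ(1−τ)) and θ₂ = √(2/(τ(1−τ))). Then for every y ∈ ℝ, ∫₀^∞ exp(−w) · (2π σ² θ₂² w)^{−1/2} · exp(−(y − μ − σθ₁ w)² / (2 σ² θ₂² w)) dw = (τ(1−τ)/σ) · exp(−ρ_τ((y−μ)/σ)). -/
open MeasureTheory

/-- The quantile check loss function at level `τ`: `ρ_τ(u) = u * (τ - 1_{u<0})`. -/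
noncomputable def checkLoss (τ u : ℝ) : ℝ := u * (τ - if u < 0 then 1 else 0)

/-- The asymmetric Laplace density with location `μ`, scale `σ`, skewness `τ`. -/
noncomputable def alDensity (μ σ τ y : ℝ) : ℝ :=
  τ * (1 - τ) / σ * Real.exp (-(checkLoss τ ((y - μ) / σ)))

theorem image_mul_sub_div_Ioi {a b : ℝ} (ha : 0 < a) (hb : 0 < b) :
    (fun u : ℝ => b * u - a / u) '' Set.Ioi 0 = Set.univ := by
  refine Set.eq_univ_of_forall fun t => ?_
  have hab : 0 < 4 * a * b := by positivity
  have hs : Real.sqrt (t ^ 2 + 4 * a * b) ^ 2 = t ^ 2 + 4 * a * b :=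
    Real.sq_sqrt (by positivity)
  have hlt : |t| < Real.sqrt (t ^ 2 + 4 * a * b) := by
    rw [← Real.sqrt_sq_eq_abs]
    exact Real.sqrt_lt_sqrt (sq_nonneg t) (by linarith)
  have hpos : 0 < t + Real.sqrt (t ^ 2 + 4 * a * b) := by
    linarith [neg_abs_le t]
  refine ⟨(t + Real.sqrt (t ^ 2 + 4 * a * b)) / (2 * b), div_pos hpos (by positivity), ?_⟩
  generalize Real.sqrt (t ^ 2 + 4 * a * b) = s at *
  simp only
  field_simp
  linear_combination hs

theorem injOn_mul_sub_div_Ioi {a b : ℝ} (ha : 0 < a) (hb : 0 < b) :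
    Set.InjOn (fun u : ℝ => b * u - a / u) (Set.Ioi 0) := by
  refine StrictMonoOn.injOn fun u hu v hv huv => ?_
  have hu' : (0 : ℝ) < u := hu
  have h₁ : b * u < b * v := by gcongr
  have h₂ : a / v < a / u := by gcongr
  linarith

theorem hasDerivWithinAt_mul_sub_div (a b : ℝ) {u : ℝ} (hu : u ≠ 0) (s : Set ℝ) :
    HasDerivWithinAt (fun u : ℝ => b * u - a / u) (b + a / u ^ 2) s u := by
  have h := (((hasDerivAt_id u).const_mul b).sub ((hasDerivAt_inv hu).const_mul a))
  refine (h.congr_deriv ?_).hasDerivWithinAt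
  field_simp
  ring

/-- The Cauchy–Schlömilch substitution applied to the Gaussian. -/
theorem integral_exp_neg_sq_mul_sub_div {a b : ℝ} (ha : 0 < a) (hb : 0 < b) :
    ∫ u in Set.Ioi (0 : ℝ), Real.exp (-(b * u - a / u) ^ 2) = Real.sqrt Real.pi / (2 * b) := by
  have hderiv : ∀ u ∈ Set.Ioi (0 : ℝ), HasDerivWithinAt (fun u : ℝ => b * u - a / u)
      (b + a / u ^ 2) (Set.Ioi 0) u :=
    fun u hu => hasDerivWithinAt_mul_sub_div a b (ne_of_gt hu) _
  have hinj := injOn_mul_sub_div_Ioi ha hb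
  have habs : ∀ u : ℝ, |b + a / u ^ 2| = b + a / u ^ 2 := fun u => abs_of_nonneg (by positivity)
  have hgauss : Integrable fun t : ℝ => Real.exp (-t ^ 2) := by
    simpa using integrable_exp_neg_mul_sq one_pos
  have hint := integrableOn_image_iff_integrableOn_abs_deriv_smul measurableSet_Ioi hderiv hinj
    (fun t => Real.exp (-t ^ 2))
  have hval := integral_image_eq_integral_abs_deriv_smul measurableSet_Ioi hderiv hinj
    (fun t => Real.exp (-t ^ 2))
  rw [image_mul_sub_div_Ioi ha hb] at hint hval
  simp only [habs, smul_eq_mul, integrableOn_univ, Measure.restrict_univ] at hint hval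
  have hint' := hint.1 hgauss
  have hval' : ∫ t : ℝ, Real.exp (-t ^ 2) = Real.sqrt Real.pi := by
    simpa using integral_gaussian 1
  rw [hval'] at hval
  have hmeas : Measurable fun u : ℝ => Real.exp (-(b * u - a / u) ^ 2) := by fun_prop
  have hg : IntegrableOn (fun u : ℝ => b * Real.exp (-(b * u - a / u) ^ 2)) (Set.Ioi 0) := by
    refine Integrable.mono' hint' (by fun_prop) (ae_of_all _ fun u => ?_)
    rw [Real.norm_of_nonneg (by positivity)]
    gcongr
    have : 0 ≤ a / u ^ 2 := by positivity
    linarith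
  have hg' : IntegrableOn (fun u : ℝ => a / u ^ 2 * Real.exp (-(b * u - a / u) ^ 2))
      (Set.Ioi 0) := by
    refine (hint'.sub hg).congr (ae_of_all _ fun u => ?_)
    simp only [Pi.sub_apply]
    ring
  have hrefl : ∫ u in Set.Ioi (0 : ℝ), b * Real.exp (-(b * u - a / u) ^ 2) =
      ∫ u in Set.Ioi (0 : ℝ), a / u ^ 2 * Real.exp (-(b * u - a / u) ^ 2) := by
    have himg : (fun u : ℝ => a / b * u⁻¹) '' Set.Ioi 0 = Set.Ioi 0 := by
      ext v
      constructor
      · rintro ⟨u, hu, rfl⟩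
        have hu' : (0 : ℝ) < u := hu
        exact Set.mem_Ioi.2 (by positivity)
      · intro hv
        have hv' : (0 : ℝ) < v := hv
        refine ⟨a / b * v⁻¹, Set.mem_Ioi.2 (by positivity), ?_⟩
        simp only
        field_simp
    have hinj' : Set.InjOn (fun u : ℝ => a / b * u⁻¹) (Set.Ioi 0) := fun u _ v _ huv =>
      inv_injective (mul_left_cancel₀ (div_pos ha hb).ne' huv)
    have h := integral_image_eq_integral_abs_deriv_smul measurableSet_Ioi
      (fun u hu => ((hasDerivAt_inv (ne_of_gt hu)).const_mul (a / b)).hasDerivWithinAt) hinj'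
      (fun u => b * Real.exp (-(b * u - a / u) ^ 2))
    rw [himg] at h
    rw [h]
    refine setIntegral_congr_fun measurableSet_Ioi fun u hu => ?_
    have hu' : (0 : ℝ) < u := hu
    have h₁ : |a / b * -(u ^ 2)⁻¹| = a / b * (u ^ 2)⁻¹ := by
      rw [mul_neg, abs_neg, abs_of_pos (by positivity)]
    have h₂ : b * (a / b * u⁻¹) - a / (a / b * u⁻¹) = -(b * u - a / u) := by
      field_simp
      ring
    simp only [h₁, h₂, smul_eq_mul, neg_sq]
    field_simp
  have hsum : Real.sqrt Real.pi =
      (∫ u in Set.Ioi (0 : ℝ), b * Real.exp (-(b * u - a / u) ^ 2)) +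
        ∫ u in Set.Ioi (0 : ℝ), a / u ^ 2 * Real.exp (-(b * u - a / u) ^ 2) := by
    rw [hval, ← integral_add hg hg']
    simp only [add_mul]
  rw [← hrefl, integral_const_mul] at hsum
  rw [hsum]
  field_simp
  ring

theorem integral_exp_neg_mul_sq_add_div_sq {a b : ℝ} (ha : 0 ≤ a) (hb : 0 < b) :
    ∫ u in Set.Ioi (0 : ℝ), Real.exp (-(b ^ 2 * u ^ 2 + a ^ 2 / u ^ 2)) =
      Real.sqrt Real.pi / (2 * b) * Real.exp (-(2 * a * b)) := by
  rcases ha.eq_or_lt with rfl | ha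
  · have h := integral_gaussian_Ioi (b ^ 2)
    rw [Real.sqrt_div Real.pi_nonneg, Real.sqrt_sq hb.le] at h
    simp only [neg_mul] at h
    simp [h]
    field_simp
  · rw [← integral_exp_neg_sq_mul_sub_div ha hb, ← integral_mul_const]
    refine setIntegral_congr_fun measurableSet_Ioi fun u hu => ?_
    have hu' : (0 : ℝ) < u := hu
    simp only [← Real.exp_add]
    congr 1
    field_simp
    ring

/-- Gaussian location–scale mixture representation of the asymmetric Laplace density:
mixing a Gaussian `N(μ + σθ₁w, σ²θ₂²w)` with an `Exp(1)` weight `w` yields the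
asymmetric Laplace density, where `θ₁ = (1-2τ)/(τ(1-τ))` and `θ₂ = √(2/(τ(1-τ)))`. -/
theorem al_density_gaussian_mixture (τ σ μ : ℝ) (hτ : τ ∈ Set.Ioo (0 : ℝ) 1)
    (hσ : 0 < σ) (θ₁ θ₂ : ℝ)
    (hθ₁ : θ₁ = (1 - 2 * τ) / (τ * (1 - τ)))
    (hθ₂ : θ₂ = Real.sqrt (2 / (τ * (1 - τ)))) (y : ℝ) :
    ∫ w in Set.Ioi (0 : ℝ),
        Real.exp (-w) * (2 * Real.pi * σ ^ 2 * θ₂ ^ 2 * w) ^ (-(1 : ℝ) / 2) *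
          Real.exp (-(y - μ - σ * θ₁ * w) ^ 2 / (2 * σ ^ 2 * θ₂ ^ 2 * w))
      = alDensity μ σ τ y := by
  obtain ⟨h0, h1⟩ := hτ
  obtain ⟨r, hr, hrr⟩ : ∃ r : ℝ, 0 < r ∧ r ^ 2 = τ * (1 - τ) :=
    ⟨_, Real.sqrt_pos.2 (mul_pos h0 (sub_pos.2 h1)),
      Real.sq_sqrt (mul_pos h0 (sub_pos.2 h1)).le⟩
  rw [← hrr] at hθ₁ hθ₂
  have hθ : θ₂ ^ 2 = 2 / r ^ 2 := by rw [hθ₂, Real.sq_sqrt (by positivity)]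
  obtain ⟨z, hz⟩ : ∃ z, z = (y - μ) / σ := ⟨_, rfl⟩
  have hy : y - μ = σ * z := by rw [hz]; field_simp
  have hpi2 : Real.sqrt Real.pi ^ 2 = Real.pi := Real.sq_sqrt Real.pi_nonneg
  have hloss : -(checkLoss τ z) = z * (1 - 2 * τ) / 2 + -(|z| / 2) := by
    unfold checkLoss
    split_ifs with hneg
    · rw [abs_of_neg hneg]; ring
    · rw [abs_of_nonneg (not_lt.1 hneg)]; ring
  have hK := integral_exp_neg_mul_sq_add_div_sq (a := |z| * r / 2) (b := 1 / (2 * r))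
    (by positivity) (by positivity)
  rw [← integral_comp_rpow_Ioi_of_pos two_pos]
  have hcongr : ∀ u ∈ Set.Ioi (0 : ℝ),
      (2 * u ^ ((2 : ℝ) - 1)) • (Real.exp (-u ^ (2 : ℝ)) *
          (2 * Real.pi * σ ^ 2 * θ₂ ^ 2 * u ^ (2 : ℝ)) ^ (-(1 : ℝ) / 2) *
          Real.exp (-(y - μ - σ * θ₁ * u ^ (2 : ℝ)) ^ 2 /
            (2 * σ ^ 2 * θ₂ ^ 2 * u ^ (2 : ℝ)))) =
        r / (σ * Real.sqrt Real.pi) * Real.exp (z * (1 - 2 * τ) / 2) *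
          Real.exp (-((1 / (2 * r)) ^ 2 * u ^ 2 + (|z| * r / 2) ^ 2 / u ^ 2)) := by
    intro u hu
    have hu' : (0 : ℝ) < u := hu
    have hpow : (2 * Real.pi * σ ^ 2 * θ₂ ^ 2 * u ^ 2) ^ (-(1 : ℝ) / 2) =
        r / (2 * σ * Real.sqrt Real.pi * u) := by
      have hbase : 2 * Real.pi * σ ^ 2 * θ₂ ^ 2 * u ^ 2 =
          (2 * σ * Real.sqrt Real.pi * u / r) ^ 2 := by
        rw [hθ, div_pow, mul_pow, mul_pow, hpi2]
        field_simp
      rw [hbase, neg_div, Real.rpow_neg (by positivity), ← Real.sqrt_eq_rpow,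
        Real.sqrt_sq (by positivity), inv_div]
    have hexp : -u ^ 2 + -(y - μ - σ * θ₁ * u ^ 2) ^ 2 / (2 * σ ^ 2 * θ₂ ^ 2 * u ^ 2) =
        z * (1 - 2 * τ) / 2 +
          -((1 / (2 * r)) ^ 2 * u ^ 2 + (|z| * r / 2) ^ 2 / u ^ 2) := by
      rw [hθ, hy, hθ₁, div_pow (|z| * r), mul_pow |z|, sq_abs]
      field_simp
      linear_combination (-4 * u ^ 4) * hrr
    simp only [Real.rpow_two, smul_eq_mul, hpow]
    norm_num only [Real.rpow_one]
    calc _ = r / (σ * Real.sqrt Real.pi) * (Real.exp (-u ^ 2) *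
          Real.exp (-(y - μ - σ * θ₁ * u ^ 2) ^ 2 / (2 * σ ^ 2 * θ₂ ^ 2 * u ^ 2))) := by
          field_simp
      _ = _ := by rw [← Real.exp_add, hexp, Real.exp_add, mul_assoc]
  rw [setIntegral_congr_fun measurableSet_Ioi hcongr, integral_const_mul, hK, alDensity, ← hz,
    hloss, ← hrr, Real.exp_add]
  have hab : 2 * (|z| * r / 2) * (1 / (2 * r)) = |z| / 2 := by field_simp
  rw [hab]
  field_simp
end

section
/- Evaluation of the mixture quantile integral at the asymmetric Laplace skewness link: for every τ ∈ (0,1), ∫₀^∞ exp(−w) · Φ(−((1−2τ)/√(2τ(1−τ))) · √w) dw = τ, where Φ is the standard normal cumulative distribution function. -/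
open MeasureTheory

/-- The standard normal cumulative distribution function. -/
noncomputable def stdNormalCDF (x : ℝ) : ℝ :=
  ∫ t in Set.Iic x, (Real.sqrt (2 * Real.pi))⁻¹ * Real.exp (-t ^ 2 / 2)

theorem integrable_stdNormal_density :
    Integrable fun t : ℝ => (Real.sqrt (2 * Real.pi))⁻¹ * Real.exp (-t ^ 2 / 2) := by
  refine ((integrable_exp_neg_mul_sq (b := 1 / 2) (by norm_num)).const_mul
    (Real.sqrt (2 * Real.pi))⁻¹).congr (.of_forall fun t => ?_)
  ring_nf

theorem stdNormalCDF_nonneg (x : ℝ) : 0 ≤ stdNormalCDF x :=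
  integral_nonneg fun t => by positivity

theorem stdNormalCDF_le_one (x : ℝ) : stdNormalCDF x ≤ 1 := by
  calc stdNormalCDF x ≤ ∫ t, (Real.sqrt (2 * Real.pi))⁻¹ * Real.exp (-t ^ 2 / 2) :=
        setIntegral_le_integral integrable_stdNormal_density
          (.of_forall fun t => by positivity)
    _ = (Real.sqrt (2 * Real.pi))⁻¹ * ∫ t : ℝ, Real.exp (-(1 / 2) * t ^ 2) := by
        rw [← integral_const_mul]
        congr with t
        ring_nf
    _ = 1 := by
        rw [integral_gaussian, show Real.pi / (1 / 2) = 2 * Real.pi by ring]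
        exact inv_mul_cancel₀ (by positivity)

theorem stdNormalCDF_zero : stdNormalCDF 0 = 1 / 2 := by
  have h := integral_comp_neg_Iic (0 : ℝ) fun t : ℝ => Real.exp (-(1 / 2) * t ^ 2)
  rw [neg_zero, integral_gaussian_Ioi, show Real.pi / (1 / 2) = 2 * Real.pi by ring] at h
  have h' : stdNormalCDF 0 =
      (Real.sqrt (2 * Real.pi))⁻¹ * ∫ t in Set.Iic (0 : ℝ), Real.exp (-(1 / 2) * (-t) ^ 2) := by
    rw [stdNormalCDF, ← integral_const_mul]
    congr with t
    ring_nf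
  have hpi : Real.sqrt (2 * Real.pi) ≠ 0 := by positivity
  rw [h', h]
  field_simp

theorem hasDerivAt_stdNormalCDF (x : ℝ) :
    HasDerivAt stdNormalCDF ((Real.sqrt (2 * Real.pi))⁻¹ * Real.exp (-x ^ 2 / 2)) x := by
  have hcont : Continuous fun t : ℝ =>
      (Real.sqrt (2 * Real.pi))⁻¹ * Real.exp (-t ^ 2 / 2) := by fun_prop
  have h : stdNormalCDF = fun y => stdNormalCDF 0 +
      ∫ t in (0 : ℝ)..y, (Real.sqrt (2 * Real.pi))⁻¹ * Real.exp (-t ^ 2 / 2) := by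
    funext y
    rw [← intervalIntegral.integral_Iic_sub_Iic integrable_stdNormal_density.integrableOn
      integrable_stdNormal_density.integrableOn]
    simp only [stdNormalCDF]
    ring
  rw [h]
  exact (hcont.integral_hasStrictDerivAt 0 x).hasDerivAt.const_add _

theorem continuous_stdNormalCDF : Continuous stdNormalCDF :=
  continuous_iff_continuousAt.2 fun x => (hasDerivAt_stdNormalCDF x).continuousAt

theorem integrableOn_exp_neg_mul_stdNormalCDF (c : ℝ) :
    IntegrableOn (fun w : ℝ => Real.exp (-w) * stdNormalCDF (c * Real.sqrt w)) (Set.Ioi 0) := by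
  refine (integrableOn_exp_neg_Ioi 0).mono' ?_ (.of_forall fun w => ?_)
  · exact (Continuous.mul (by fun_prop)
      (continuous_stdNormalCDF.comp (by fun_prop))).aestronglyMeasurable
  · rw [Real.norm_of_nonneg (mul_nonneg (Real.exp_nonneg _) (stdNormalCDF_nonneg _))]
    exact mul_le_of_le_one_right (Real.exp_nonneg _) (stdNormalCDF_le_one _)

theorem integral_exp_neg_mul_stdNormalCDF (c : ℝ) :
    ∫ w in Set.Ioi (0 : ℝ), Real.exp (-w) * stdNormalCDF (c * Real.sqrt w)
      = 1 / 2 + c / (2 * Real.sqrt (2 + c ^ 2)) := by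
  have hb : 0 < 1 + c ^ 2 / 2 := by positivity
  set k : ℝ := c / (2 * Real.sqrt (2 * Real.pi)) with hk
  set g : ℝ → ℝ := fun w =>
    k * (w ^ ((1 / 2 : ℝ) - 1) * Real.exp (-((1 + c ^ 2 / 2) * w))) with hg
  have hgint : IntegrableOn g (Set.Ioi 0) := by
    refine Integrable.const_mul (IntegrableOn.congr_fun (integrableOn_rpow_mul_exp_neg_mul_rpow
      (p := 1) (s := (1 / 2 : ℝ) - 1) (by norm_num) one_pos hb) (fun w _ => ?_)
      measurableSet_Ioi) k
    simp only [Real.rpow_one, neg_mul]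
  have hgval : ∫ w in Set.Ioi (0 : ℝ), g w = c / (2 * Real.sqrt (2 + c ^ 2)) := by
    rw [hg, integral_const_mul, Real.integral_rpow_mul_exp_neg_mul_Ioi (by norm_num) hb,
      Real.Gamma_one_half_eq, ← Real.sqrt_eq_rpow, hk,
      show 2 + c ^ 2 = 2 * (1 + c ^ 2 / 2) by ring, Real.sqrt_mul (by norm_num),
      Real.sqrt_mul (by norm_num), Real.sqrt_div (by norm_num), Real.sqrt_one]
    have : Real.sqrt (1 + c ^ 2 / 2) ≠ 0 := by positivity
    have : Real.sqrt Real.pi ≠ 0 := by positivity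
    field_simp
  have hderiv : ∀ w ∈ Set.Ioi (0 : ℝ),
      HasDerivAt (fun w => -(Real.exp (-w) * stdNormalCDF (c * Real.sqrt w)))
        (Real.exp (-w) * stdNormalCDF (c * Real.sqrt w) - g w) w := by
    intro w hw
    have hw : 0 < w := hw
    have h1 := ((hasDerivAt_id w).neg).exp
    have h2 := (hasDerivAt_stdNormalCDF (c * Real.sqrt w)).comp w
      ((Real.hasDerivAt_sqrt hw.ne').const_mul c)
    refine (h1.mul h2).neg.congr_deriv ?_
    have hr : w ^ ((1 / 2 : ℝ) - 1) = (Real.sqrt w)⁻¹ := by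
      rw [Real.sqrt_eq_rpow, ← Real.rpow_neg hw.le]
      norm_num
    have he : Real.exp (-((1 + c ^ 2 / 2) * w)) =
        Real.exp (-w) * Real.exp (-(c * Real.sqrt w) ^ 2 / 2) := by
      rw [← Real.exp_add, mul_pow, Real.sq_sqrt hw.le]
      ring_nf
    simp only [hg, hk, hr, he, Function.comp_apply, Pi.neg_apply, id]
    have : Real.sqrt w ≠ 0 := by positivity
    have : Real.sqrt (2 * Real.pi) ≠ 0 := by positivity
    field_simp
    ring
  have hlim : Filter.Tendsto (fun w => -(Real.exp (-w) * stdNormalCDF (c * Real.sqrt w)))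
      Filter.atTop (nhds 0) := by
    rw [← neg_zero]
    refine (squeeze_zero (fun w => mul_nonneg (Real.exp_nonneg _) (stdNormalCDF_nonneg _))
      (fun w => mul_le_of_le_one_right (Real.exp_nonneg _) (stdNormalCDF_le_one _))
      Real.tendsto_exp_neg_atTop_nhds_zero).neg
  have hcont : Continuous fun w => -(Real.exp (-w) * stdNormalCDF (c * Real.sqrt w)) :=
    (Continuous.mul (by fun_prop) (continuous_stdNormalCDF.comp (by fun_prop))).neg
  have hint := integrableOn_exp_neg_mul_stdNormalCDF c
  have h := integral_Ioi_of_hasDerivAt_of_tendsto hcont.continuousWithinAt hderiv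
    (hint.sub hgint) hlim
  rw [integral_sub hint hgint, hgval] at h
  simp only [Real.sqrt_zero, mul_zero, neg_zero, Real.exp_zero, one_mul, stdNormalCDF_zero] at h
  linarith

/-- Evaluation of the mixture quantile integral at the asymmetric Laplace skewness link:
`∫₀^∞ exp(-w) Φ(-((1-2τ)/√(2τ(1-τ)))√w) dw = τ` for every `τ ∈ (0,1)`. -/
theorem mixture_quantile_integral_at_al_link (τ : ℝ) (hτ : τ ∈ Set.Ioo (0 : ℝ) 1) :
    ∫ w in Set.Ioi (0 : ℝ),
        Real.exp (-w) *
          stdNormalCDF (-((1 - 2 * τ) / Real.sqrt (2 * τ * (1 - τ))) * Real.sqrt w)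
      = τ := by
  obtain ⟨h0, h1⟩ := hτ
  have hq : 0 < 2 * τ * (1 - τ) := mul_pos (by linarith) (by linarith)
  have hs : Real.sqrt (2 * τ * (1 - τ)) ≠ 0 := (Real.sqrt_pos.2 hq).ne'
  have hsq : 2 + (-((1 - 2 * τ) / Real.sqrt (2 * τ * (1 - τ)))) ^ 2 =
      (2 * τ * (1 - τ))⁻¹ := by
    rw [neg_sq, div_pow, Real.sq_sqrt hq.le]
    refine eq_inv_of_mul_eq_one_left ?_
    rw [add_mul, div_mul_cancel₀ _ hq.ne']
    ring
  rw [integral_exp_neg_mul_stdNormalCDF, hsq, Real.sqrt_inv]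
  field_simp
  ring
end

section
/- (Proposition 1, univariate form.) Fix τ ∈ (0,1), μ ∈ ℝ, σ > 0, and set θ₂ = √(2/(τ(1−τ))). Let W be exponentially distributed with rate 1, let Z be standard normal independent of W, and for a parameter θ₁ ∈ ℝ set Y = μ + σθ₁ W + σθ₂ √W · Z. Then P(Y ≤ μ) = τ if and only if θ₁ = (1−2τ)/(τ(1−τ)). -/
open MeasureTheory ProbabilityTheory

theorem nullSingletonClass_expMeasure (r : ℝ) : NullSingletonClass (expMeasure r) := by
  exact ⟨fun x => withDensity_absolutelyContinuous _ _ (measure_singleton x)⟩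

theorem expMeasure_one_real_Iic {t : ℝ} (ht : 0 ≤ t) :
    (expMeasure 1).real (Set.Iic t) = 1 - Real.exp (-t) := by
  have := isProbabilityMeasure_expMeasure one_pos
  rw [← cdf_eq_real, cdf_expMeasure_eq one_pos, if_pos ht, one_mul]

theorem expMeasure_one_real_Ici {t : ℝ} (ht : 0 ≤ t) :
    (expMeasure 1).real (Set.Ici t) = Real.exp (-t) := by
  have := isProbabilityMeasure_expMeasure one_pos
  have := nullSingletonClass_expMeasure 1
  have h := probReal_compl_eq_one_sub (μ := expMeasure 1) (measurableSet_Iic (a := t))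
  rw [expMeasure_one_real_Iic ht, Set.compl_Iic] at h
  rw [← measureReal_congr Ioi_ae_eq_Ici, h]
  ring

theorem ae_expMeasure_one_pos : ∀ᵐ w ∂(expMeasure 1), 0 < w := by
  have := isProbabilityMeasure_expMeasure one_pos
  have h := expMeasure_one_real_Iic le_rfl
  rw [neg_zero, Real.exp_zero, sub_self, measureReal_eq_zero_iff] at h
  rw [ae_iff]
  convert h using 2
  ext w
  simp

theorem setIntegral_Ioi_exp_neg_mul_sq_gaussianReal {c : ℝ} (hc : 0 ≤ c) :
    ∫ z in Set.Ioi 0, Real.exp (-(c * z ^ 2)) ∂(gaussianReal 0 1) = 1 / (2 * √(1 + 2 * c)) := by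
  rw [← integral_indicator measurableSet_Ioi,
    integral_gaussianReal_eq_integral_smul one_ne_zero]
  have h : ∀ z : ℝ, gaussianPDFReal 0 1 z •
      (Set.Ioi 0).indicator (fun z => Real.exp (-(c * z ^ 2))) z =
      (Set.Ioi 0).indicator
        (fun z => (√(2 * Real.pi))⁻¹ * Real.exp (-(c + 1 / 2) * z ^ 2)) z := by
    intro z
    by_cases hz : z ∈ Set.Ioi (0 : ℝ)
    · simp only [Set.indicator_of_mem hz, gaussianPDFReal, smul_eq_mul, NNReal.coe_one, mul_one,
        sub_zero, mul_assoc, ← Real.exp_add]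
      congr 2
      ring
    · simp [Set.indicator_of_notMem hz]
  simp_rw [h]
  rw [integral_indicator measurableSet_Ioi, integral_const_mul, integral_gaussian_Ioi]
  have hp : 0 < 2 * Real.pi := by positivity
  have e : Real.pi / (c + 1 / 2) = (2 * Real.pi) / (1 + 2 * c) := by
    field_simp
    ring
  rw [e, Real.sqrt_div hp.le]
  have := Real.sqrt_pos.2 hp
  field_simp

theorem setIntegral_Iic_exp_neg_mul_sq_gaussianReal {c : ℝ} (hc : 0 ≤ c) :
    ∫ z in Set.Iic 0, Real.exp (-(c * z ^ 2)) ∂(gaussianReal 0 1) = 1 / (2 * √(1 + 2 * c)) := by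
  have := nullSingletonClass_gaussianReal (μ := 0) (v := 1) one_ne_zero
  have hmap : (gaussianReal 0 1).map (fun z : ℝ => -z) = gaussianReal 0 1 := by
    rw [gaussianReal_map_neg, neg_zero]
  rw [← setIntegral_Ioi_exp_neg_mul_sq_gaussianReal hc, ← integral_Ici_eq_integral_Ioi]
  conv_lhs => rw [← hmap]
  rw [setIntegral_map measurableSet_Iic (by fun_prop) (by fun_prop)]
  simp

theorem gaussianReal_real_Iic_zero : (gaussianReal 0 1).real (Set.Iic 0) = 1 / 2 := by
  simpa using setIntegral_Iic_exp_neg_mul_sq_gaussianReal le_rfl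

theorem integrable_exp_neg_mul_sq_gaussianReal {c : ℝ} (hc : 0 ≤ c) :
    Integrable (fun z : ℝ => Real.exp (-(c * z ^ 2))) (gaussianReal 0 1) := by
  refine Integrable.of_bound (by fun_prop) 1 (.of_forall fun z => ?_)
  rw [Real.norm_eq_abs, Real.abs_exp, Real.exp_le_one_iff]
  have : 0 ≤ c * z ^ 2 := by positivity
  linarith

theorem one_div_two_mul_sqrt_one_add {b : ℝ} (hb : b ≠ 0) :
    1 / (2 * √(1 + 2 * (b ^ 2)⁻¹)) = |b| / √(b ^ 2 + 2) / 2 := by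
  have e : 1 + 2 * (b ^ 2)⁻¹ = (b ^ 2 + 2) / b ^ 2 := by field_simp
  rw [e, Real.sqrt_div (by positivity), Real.sqrt_sq_eq_abs]
  have : 0 < |b| := abs_pos.2 hb
  field_simp

theorem prod_real_apply_symm {α β : Type*} [MeasurableSpace α] [MeasurableSpace β]
    (μ : Measure α) (ν : Measure β) [IsProbabilityMeasure μ] [IsProbabilityMeasure ν]
    {s : Set (α × β)} (hs : MeasurableSet s) :
    (μ.prod ν).real s = ∫ y, μ.real ((fun x => (x, y)) ⁻¹' s) ∂ν := by
  simp only [Measure.real]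
  rw [Measure.prod_apply_symm hs, integral_toReal (measurable_measure_prodMk_right hs).aemeasurable
    (.of_forall fun y => measure_lt_top _ _)]

theorem exp_prod_gaussian_real_mul_sqrt_add_nonpos (b : ℝ) :
    ((expMeasure 1).prod (gaussianReal 0 1)).real {p : ℝ × ℝ | b * √p.1 + p.2 ≤ 0} =
      (1 - b / √(b ^ 2 + 2)) / 2 := by
  have := isProbabilityMeasure_expMeasure one_pos
  have hc : 0 ≤ (b ^ 2)⁻¹ := by positivity
  rw [prod_real_apply_symm _ _ (measurableSet_le (by fun_prop) (by fun_prop))]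
  simp only [Set.preimage_ofPred_eq]
  rcases lt_trichotomy b 0 with hb | rfl | hb
  · have h : ∀ z : ℝ, (expMeasure 1).real {w | b * √w + z ≤ 0} =
        (Set.Iic 0).indicator (fun _ => (1 : ℝ)) z +
        (Set.Ioi 0).indicator (fun z => Real.exp (-((b ^ 2)⁻¹ * z ^ 2))) z := by
      intro z
      rcases le_or_gt z 0 with hz | hz
      · have : {w : ℝ | b * √w + z ≤ 0} = Set.univ := by
          ext w
          have := mul_nonneg (neg_nonneg.2 hb.le) (Real.sqrt_nonneg w)
          simp only [Set.mem_ofPred_eq, Set.mem_univ, iff_true]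
          linarith
        simp [this, hz]
      · have : {w : ℝ | b * √w + z ≤ 0} = Set.Ici ((b ^ 2)⁻¹ * z ^ 2) := by
          ext w
          have hb' : 0 < -b := by linarith
          have e : (b ^ 2)⁻¹ * z ^ 2 = (z / -b) ^ 2 := by field_simp
          rw [Set.mem_Ici, e, ← Real.le_sqrt' (by positivity), div_le_iff₀ hb', Set.mem_ofPred_eq]
          constructor <;> intro h <;> linarith
        rw [this, expMeasure_one_real_Ici (by positivity)]
        simp [hz]
    simp_rw [h]
    rw [integral_add ((integrable_const _).indicator measurableSet_Iic)
      ((integrable_exp_neg_mul_sq_gaussianReal hc).indicator measurableSet_Ioi),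
      integral_indicator measurableSet_Iic, integral_indicator measurableSet_Ioi,
      setIntegral_Ioi_exp_neg_mul_sq_gaussianReal hc, one_div_two_mul_sqrt_one_add hb.ne,
      abs_of_neg hb, setIntegral_const, gaussianReal_real_Iic_zero, smul_eq_mul]
    ring
  · have h : ∀ z : ℝ, (expMeasure 1).real {w | 0 * √w + z ≤ 0} =
        (Set.Iic 0).indicator (fun _ => (1 : ℝ)) z := by
      intro z
      by_cases hz : z ≤ 0 <;> simp [hz]
    simp_rw [h]
    rw [integral_indicator measurableSet_Iic, setIntegral_const, gaussianReal_real_Iic_zero]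
    simp
  · have h : ∀ z : ℝ, (expMeasure 1).real {w | b * √w + z ≤ 0} =
        (Set.Iic 0).indicator (fun z => 1 - Real.exp (-((b ^ 2)⁻¹ * z ^ 2))) z := by
      intro z
      rcases le_or_gt z 0 with hz | hz
      · have : {w : ℝ | b * √w + z ≤ 0} = Set.Iic ((b ^ 2)⁻¹ * z ^ 2) := by
          ext w
          have hz' : 0 ≤ -z := by linarith
          have e : (b ^ 2)⁻¹ * z ^ 2 = (-z / b) ^ 2 := by field_simp
          rw [Set.mem_Iic, e, ← Real.sqrt_le_left (by positivity), le_div_iff₀ hb,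
            Set.mem_ofPred_eq]
          constructor <;> intro h <;> linarith
        rw [this, expMeasure_one_real_Iic (by positivity)]
        simp [hz]
      · have : {w : ℝ | b * √w + z ≤ 0} = ∅ := by
          ext w
          have := mul_nonneg hb.le (Real.sqrt_nonneg w)
          simp only [Set.mem_ofPred_eq, Set.mem_empty_iff_false, iff_false]
          linarith
        simp [this, hz]
    simp_rw [h]
    rw [integral_indicator measurableSet_Iic,
      integral_sub (integrable_const _) (integrable_exp_neg_mul_sq_gaussianReal hc).integrableOn,
      setIntegral_Iic_exp_neg_mul_sq_gaussianReal hc, one_div_two_mul_sqrt_one_add hb.ne',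
      abs_of_pos hb, setIntegral_const, gaussianReal_real_Iic_zero, smul_eq_mul]
    ring

/-- Proposition 1 (univariate form): for the Gaussian location–scale mixture
`Y = μ + σθ₁W + σθ₂√W Z` with `W ~ Exp(1)`, `Z ~ N(0,1)` independent and
`θ₂ = √(2/(τ(1-τ)))`, the location `μ` is the `τ`-quantile of `Y`, i.e. `P(Y ≤ μ) = τ`,
if and only if `θ₁ = (1-2τ)/(τ(1-τ))`. -/
theorem al_quantile_iff_skewness (τ μ σ θ₁ : ℝ) (hτ : τ ∈ Set.Ioo (0 : ℝ) 1)
    (hσ : 0 < σ) (θ₂ : ℝ) (hθ₂ : θ₂ = Real.sqrt (2 / (τ * (1 - τ)))) :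
    (((expMeasure 1).prod (gaussianReal 0 1))
        {p : ℝ × ℝ | μ + σ * θ₁ * p.1 + σ * θ₂ * Real.sqrt p.1 * p.2 ≤ μ}).toReal = τ
      ↔ θ₁ = (1 - 2 * τ) / (τ * (1 - τ)) := by
  have := isProbabilityMeasure_expMeasure one_pos
  obtain ⟨h0, h1⟩ := hτ
  have h1' : 0 < 1 - τ := by linarith
  have hpos : 0 < θ₂ := by rw [hθ₂]; positivity
  have hsq : θ₂ ^ 2 = 2 / (τ * (1 - τ)) := by rw [hθ₂]; exact Real.sq_sqrt (by positivity)
  have hae : {p : ℝ × ℝ | μ + σ * θ₁ * p.1 + σ * θ₂ * √p.1 * p.2 ≤ μ}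
      =ᵐ[(expMeasure 1).prod (gaussianReal 0 1)]
      {p : ℝ × ℝ | θ₁ / θ₂ * √p.1 + p.2 ≤ 0} := by
    filter_upwards [Measure.quasiMeasurePreserving_fst.ae ae_expMeasure_one_pos] with p hp
    have hs : 0 < √p.1 := Real.sqrt_pos.2 hp
    have e : μ + σ * θ₁ * p.1 + σ * θ₂ * √p.1 * p.2 =
        μ + σ * θ₂ * √p.1 * (θ₁ / θ₂ * √p.1 + p.2) := by
      nth_rewrite 1 [← Real.mul_self_sqrt hp.le]
      field_simp
      ring
    have hk : 0 < σ * θ₂ * √p.1 := by positivity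
    refine propext ?_
    change μ + σ * θ₁ * p.1 + σ * θ₂ * √p.1 * p.2 ≤ μ ↔ θ₁ / θ₂ * √p.1 + p.2 ≤ 0
    rw [e, add_le_iff_nonpos_right, mul_nonpos_iff_pos_imp_nonpos]
    simp only [hk, forall_const]
    constructor
    · exact fun h => h.1
    · exact fun h => ⟨h, fun _ => by linarith⟩
  rw [← Measure.real, measureReal_congr hae, exp_prod_gaussian_real_mul_sqrt_add_nonpos]
  have hθ₁ : θ₁ = (1 - 2 * τ) / (τ * (1 - τ)) ↔ θ₁ / θ₂ = θ₂ * (1 - 2 * τ) / 2 := by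
    have e : (1 - 2 * τ) / (τ * (1 - τ)) = θ₂ * (1 - 2 * τ) / 2 * θ₂ := by
      rw [show θ₂ * (1 - 2 * τ) / 2 * θ₂ = θ₂ ^ 2 * (1 - 2 * τ) / 2 by ring, hsq]
      field_simp
    rw [e, div_eq_iff hpos.ne']
  rw [hθ₁]
  have hprod : θ₂ ^ 2 * (τ * (1 - τ)) = 2 := by rw [hsq]; field_simp
  generalize θ₁ / θ₂ = b
  have hs : 0 < √(b ^ 2 + 2) := by positivity
  have hs2 : √(b ^ 2 + 2) ^ 2 = b ^ 2 + 2 := Real.sq_sqrt (by positivity)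
  constructor
  · intro h
    have hb : b = (1 - 2 * τ) * √(b ^ 2 + 2) := by
      rw [← div_eq_iff hs.ne']
      linarith
    have hq : √(b ^ 2 + 2) = θ₂ / 2 := by
      rw [← sq_eq_sq₀ hs.le (by positivity)]
      have h4 : √(b ^ 2 + 2) ^ 2 * (4 * (τ * (1 - τ))) = 2 := by
        have := congrArg (· ^ 2) hb
        simp only [mul_pow] at this
        linear_combination hs2 + this
      have : 0 < τ * (1 - τ) := by positivity
      refine mul_right_cancel₀ this.ne' ?_
      linear_combination h4 / 4 - hprod / 4
    rw [hb, hq]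
    ring
  · rintro rfl
    have e : (θ₂ * (1 - 2 * τ) / 2) ^ 2 + 2 = (θ₂ / 2) ^ 2 := by
      linear_combination -hprod
    rw [e, Real.sqrt_sq (by positivity)]
    field_simp
    ring
end

section
/- (Proposition 1, marginal claim.) Let n ≥ 1, let τ₁,…,τₙ ∈ (0,1), δ₁,…,δₙ > 0, μ ∈ ℝⁿ, and let Ψ ∈ ℝ^{n×n} be symmetric positive definite with Ψ_{ii} = 1 for all i. Let L ∈ ℝ^{n×n} satisfy L Lᵀ = Ψ. Let D = diag(δ₁,…,δₙ), θ₁ = ((1−2τ₁)/(τ₁(1−τ₁)),…,(1−2τₙ)/(τₙ(1−τₙ)))ᵀ, and Θ₂ = diag(√(2/(τ₁(1−τ₁))),…,√(2/(τₙ(1−τₙ)))). Let W be exponentially distributed with rate 1 and let Z be a standard Gaussian vector on ℝⁿ (i.i.d. N(0,1) coordinates) independent of W, and define Y = μ + W·Dθ₁ + √W·D Θ₂ L Z. Then for each i ∈ {1,…,n}, the law of the i-th coordinate Y_i has density f_AL(·; μ_i, δ_i, τ_i), i.e. for every Borel set A ⊆ ℝ, P(Y_i ∈ A) = ∫_A (τ_i(1−τ_i)/δ_i)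 · exp(−ρ_{τ_i}((y−μ_i)/δ_i)) dy. -/
open MeasureTheory ProbabilityTheory

/-- The kernel `exp (-ρ_τ(u) + z u)` restricted to the left half-line is an exponential. -/
lemma exp_neg_checkLoss_eqOn_Iic (τ : ℝ) (z : ℂ) :
    Set.EqOn (fun u : ℝ ↦ Complex.exp (-(checkLoss τ u : ℂ) + z * u))
      (fun u ↦ Complex.exp ((1 - τ + z) * u)) (Set.Iic 0) := by
  intro u hu
  rcases (Set.mem_Iic.mp hu).lt_or_eq with h | rfl
  · simp only [checkLoss, if_pos h]
    push_cast
    ring_nf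
  · simp [checkLoss]

/-- The kernel `exp (-ρ_τ(u) + z u)` restricted to the right half-line is an exponential. -/
lemma exp_neg_checkLoss_eqOn_Ioi (τ : ℝ) (z : ℂ) :
    Set.EqOn (fun u : ℝ ↦ Complex.exp (-(checkLoss τ u : ℂ) + z * u))
      (fun u ↦ Complex.exp ((-τ + z) * u)) (Set.Ioi 0) := by
  intro u hu
  simp only [checkLoss, if_neg (Set.mem_Ioi.mp hu).not_gt]
  push_cast
  ring_nf

lemma integrable_exp_neg_checkLoss {τ : ℝ} {z : ℂ} (h₁ : τ - 1 < z.re) (h₂ : z.re < τ) :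
    Integrable (fun u : ℝ ↦ Complex.exp (-(checkLoss τ u : ℂ) + z * u)) := by
  rw [← integrableOn_univ, ← Set.Iic_union_Ioi (a := (0 : ℝ)), integrableOn_union,
    integrableOn_congr_fun (exp_neg_checkLoss_eqOn_Iic τ z) measurableSet_Iic,
    integrableOn_congr_fun (exp_neg_checkLoss_eqOn_Ioi τ z) measurableSet_Ioi]
  exact ⟨integrableOn_exp_mul_complex_Iic (by simp; linarith) 0,
    integrableOn_exp_mul_complex_Ioi (by simp; linarith) 0⟩

lemma integral_exp_neg_checkLoss {τ : ℝ} {z : ℂ} (h₁ : τ - 1 < z.re) (h₂ : z.re < τ) :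
    ∫ u : ℝ, Complex.exp (-(checkLoss τ u : ℂ) + z * u) = 1 / ((1 - τ + z) * (τ - z)) := by
  have hl : 0 < ((1 : ℂ) - τ + z).re := by simp; linarith
  have hr : (-(τ : ℂ) + z).re < 0 := by simp; linarith
  have hl₀ : (1 : ℂ) - τ + z ≠ 0 := fun h ↦ by simp [h] at hl
  have hr₀ : -(τ : ℂ) + z ≠ 0 := fun h ↦ by simp [h] at hr
  have hr₁ : (τ : ℂ) - z ≠ 0 := fun h ↦ hr₀ (by linear_combination -h)
  have hint := integrable_exp_neg_checkLoss h₁ h₂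
  rw [← intervalIntegral.integral_Iic_add_Ioi hint.integrableOn (b := 0) hint.integrableOn,
    setIntegral_congr_fun measurableSet_Iic (exp_neg_checkLoss_eqOn_Iic τ z),
    setIntegral_congr_fun measurableSet_Ioi (exp_neg_checkLoss_eqOn_Ioi τ z),
    integral_exp_mul_complex_Iic hl, integral_exp_mul_complex_Ioi hr]
  simp only [Complex.ofReal_zero, mul_zero, Complex.exp_zero]
  field_simp
  ring

lemma measurable_checkLoss (τ : ℝ) : Measurable (checkLoss τ) :=
  measurable_id.mul (measurable_const.sub
    (Measurable.ite measurableSet_Iio measurable_const measurable_const))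

lemma measurable_alDensity (m σ τ : ℝ) : Measurable (alDensity m σ τ) := by
  have := measurable_checkLoss τ
  unfold alDensity
  fun_prop

lemma alDensity_nonneg (m : ℝ) {σ τ : ℝ} (hτ : τ ∈ Set.Ioo (0 : ℝ) 1) (hσ : 0 < σ) (y : ℝ) :
    0 ≤ alDensity m σ τ y := by
  have h₁ := hτ.1
  have h₂ := sub_pos.mpr hτ.2
  unfold alDensity
  positivity

lemma integrable_alDensity (m : ℝ) {σ τ : ℝ} (hτ : τ ∈ Set.Ioo (0 : ℝ) 1) (hσ : 0 < σ) :
    Integrable (alDensity m σ τ) := by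
  have h := (integrable_exp_neg_checkLoss (τ := τ) (z := 0) (by simpa using hτ.2)
    (by simpa using hτ.1)).re
  have h' : Integrable (fun u ↦ Real.exp (-(checkLoss τ u))) := by
    refine h.congr (ae_of_all _ fun u ↦ ?_)
    simp [← Complex.ofReal_neg, Complex.exp_ofReal_re]
  exact ((h'.comp_div hσ.ne').comp_sub_right m).const_mul _

/-- The characteristic function of the asymmetric Laplace distribution. -/
lemma charFun_withDensity_alDensity (m : ℝ) {σ τ : ℝ} (hτ : τ ∈ Set.Ioo (0 : ℝ) 1) (hσ : 0 < σ)
    (t : ℝ) :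
    charFun (volume.withDensity fun y ↦ ENNReal.ofReal (alDensity m σ τ y)) t =
      τ * (1 - τ) * Complex.exp (t * m * Complex.I) /
        ((1 - τ + σ * t * Complex.I) * (τ - σ * t * Complex.I)) := by
  rw [charFun_apply_real, integral_withDensity_eq_integral_toReal_smul
    (measurable_alDensity m σ τ).ennreal_ofReal (by simp)]
  have hσ₀ : (σ : ℂ) ≠ 0 := mod_cast hσ.ne'
  have h : ∀ y : ℝ, (ENNReal.ofReal (alDensity m σ τ y)).toReal •
      Complex.exp (t * y * Complex.I) = τ * (1 - τ) / σ * Complex.exp (t * m * Complex.I) *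
        Complex.exp (-(checkLoss τ ((y - m) / σ) : ℂ) +
          σ * t * Complex.I * ((y - m) / σ : ℝ)) := by
    intro y
    rw [ENNReal.toReal_ofReal (alDensity_nonneg m hτ hσ y), alDensity, Complex.real_smul,
      mul_assoc (_ / _ : ℂ), ← Complex.exp_add]
    push_cast
    rw [mul_assoc (_ / _ : ℂ), ← Complex.exp_add]
    congr 2
    field_simp
    ring
  simp_rw [h]
  rw [integral_const_mul,
    integral_sub_right_eq_self (fun y : ℝ ↦ Complex.exp (-(checkLoss τ (y / σ) : ℂ) +
      σ * t * Complex.I * (y / σ : ℝ))) m,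
    Measure.integral_comp_div (fun y : ℝ ↦ Complex.exp (-(checkLoss τ y : ℂ) +
      σ * t * Complex.I * y)) σ,
    integral_exp_neg_checkLoss (by simpa using hτ.2) (by simpa using hτ.1), abs_of_pos hσ,
    Complex.real_smul]
  field_simp

lemma integral_cexp_mul_expMeasure_one {z : ℂ} (hz : z.re < 1) :
    ∫ w, Complex.exp (z * w) ∂(expMeasure 1) = 1 / (1 - z) := by
  have hz' : (-1 + z).re < 0 := by simp; linarith
  have hz₀ : -1 + z ≠ 0 := fun h ↦ by simp [h] at hz'
  have hz₁ : 1 - z ≠ 0 := fun h ↦ hz₀ (by linear_combination -h)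
  have hm : Measurable (exponentialPDF 1) := (measurable_exponentialPDFReal 1).ennreal_ofReal
  change ∫ w, _ ∂(volume.withDensity (exponentialPDF 1)) = _
  rw [integral_withDensity_eq_integral_toReal_smul hm (by simp [exponentialPDF])]
  have h : ∀ w : ℝ, (exponentialPDF 1 w).toReal • Complex.exp (z * w) =
      (Set.Ici 0).indicator (fun w : ℝ ↦ Complex.exp ((-1 + z) * w)) w := by
    intro w
    rw [exponentialPDF_eq]
    by_cases hw : 0 ≤ w
    · rw [if_pos hw, Set.indicator_of_mem (Set.mem_Ici.mpr hw), ENNReal.toReal_ofReal (by positivity),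
        Complex.real_smul, add_mul, Complex.exp_add]
      simp
    · rw [if_neg hw, Set.indicator_of_notMem (by simpa using hw)]
      simp
  simp_rw [h]
  rw [integral_indicator measurableSet_Ici, integral_Ici_eq_integral_Ioi,
    integral_exp_mul_complex_Ioi hz']
  simp only [Complex.ofReal_zero, mul_zero, Complex.exp_zero]
  field_simp
  ring

/-- A linear combination of independent standard Gaussians is Gaussian. -/
lemma map_sum_mul_pi_gaussianReal {ι : Type*} [Fintype ι] (a : ι → ℝ) (v : NNReal)
    (hv : ∑ j, a j ^ 2 = v) :
    (Measure.pi fun _ : ι ↦ gaussianReal 0 1).map (fun z ↦ ∑ j, a j * z j) =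
      gaussianReal 0 v := by
  have hm : Measurable fun z : ι → ℝ ↦ ∑ j, a j * z j := by fun_prop
  have := Measure.isProbabilityMeasure_map (μ := Measure.pi fun _ : ι ↦ gaussianReal 0 1)
    hm.aemeasurable
  refine Measure.ext_of_charFun (funext fun t ↦ ?_)
  rw [charFun_apply_real, integral_map hm.aemeasurable (by fun_prop)]
  have h : ∀ z : ι → ℝ, Complex.exp (t * (∑ j, a j * z j : ℝ) * Complex.I) =
      ∏ j, Complex.exp ((t * a j : ℝ) * z j * Complex.I) := by
    intro z
    rw [← Complex.exp_sum]
    push_cast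
    rw [Finset.mul_sum, Finset.sum_mul]
    simp only [mul_assoc]
  simp_rw [h]
  rw [integral_fintype_prod_eq_prod
    (f := fun j (x : ℝ) ↦ Complex.exp ((t * a j : ℝ) * x * Complex.I))]
  simp_rw [← charFun_apply_real, charFun_gaussianReal]
  rw [← Complex.exp_sum]
  have hv' : ((v : ℝ) : ℂ) = ∑ j, (a j : ℂ) ^ 2 := by
    rw [← hv]
    push_cast
    rfl
  rw [hv', Finset.sum_mul, Finset.sum_div]
  simp [mul_pow, mul_comm]

/-- The characteristic function of the Gaussian location-scale mixture `m + W b + √W c G` with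
`W ~ Exp(1)` and `G ~ N(0, 1)`. -/
lemma charFun_map_exp_gaussian_mixture (m b c t : ℝ) :
    charFun (((expMeasure 1).prod (gaussianReal 0 1)).map
      fun p ↦ m + p.1 * b + Real.sqrt p.1 * (c * p.2)) t =
      Complex.exp (t * m * Complex.I) / (1 - (t * b * Complex.I - (t * c) ^ 2 / 2)) := by
  have := isProbabilityMeasure_expMeasure one_pos
  have hm : Measurable fun p : ℝ × ℝ ↦ m + p.1 * b + Real.sqrt p.1 * (c * p.2) := by fun_prop
  rw [charFun_apply_real, integral_map hm.aemeasurable (by fun_prop), integral_prod]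
  swap
  · refine Integrable.of_bound (C := 1) (by fun_prop) (ae_of_all _ fun p ↦ ?_)
    rw [← Complex.ofReal_mul, Complex.norm_exp_ofReal_mul_I]
  have hpos : ∀ᵐ w ∂(expMeasure 1), 0 ≤ w := by
    change ∀ᵐ w ∂(volume.withDensity (exponentialPDF 1)), 0 ≤ w
    have hmeas : Measurable (exponentialPDF 1) := (measurable_exponentialPDFReal 1).ennreal_ofReal
    rw [ae_withDensity_iff hmeas]
    refine ae_of_all _ fun w hw ↦ ?_
    by_contra! h
    exact hw (exponentialPDF_of_neg h)
  have h : ∀ᵐ w ∂(expMeasure 1), ∫ x, Complex.exp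
      (t * (m + w * b + Real.sqrt w * (c * x) : ℝ) * Complex.I) ∂(gaussianReal 0 1) =
      Complex.exp (t * m * Complex.I) *
        Complex.exp ((t * b * Complex.I - (t * c) ^ 2 / 2) * w) := by
    filter_upwards [hpos] with w hw
    have h' : ∀ x : ℝ, Complex.exp
        (t * (m + w * b + Real.sqrt w * (c * x) : ℝ) * Complex.I) =
        Complex.exp (t * (m + w * b) * Complex.I) *
          Complex.exp ((t * Real.sqrt w * c : ℝ) * x * Complex.I) := by
      intro x
      rw [← Complex.exp_add]
      push_cast
      ring_nf
    have hs : (Real.sqrt w : ℂ) ^ 2 = w := by exact_mod_cast Real.sq_sqrt hw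
    simp_rw [h']
    rw [integral_const_mul, ← charFun_apply_real, charFun_gaussianReal, ← Complex.exp_add,
      ← Complex.exp_add]
    congr 1
    push_cast
    linear_combination (-(t * c : ℂ) ^ 2 / 2) * hs
  rw [integral_congr_ae h, integral_const_mul, integral_cexp_mul_expMeasure_one, mul_one_div]
  have : (t * b * Complex.I - (t * c) ^ 2 / 2 : ℂ).re = -((t * c) ^ 2 / 2) := by
    rw [← Complex.ofReal_mul, ← Complex.ofReal_mul, Complex.sub_re, Complex.re_ofReal_mul]
    norm_cast
    simp
  rw [this]
  nlinarith [sq_nonneg (t * c)]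

/-- The exponential mixture of Gaussians with the asymmetric Laplace parameters has the
asymmetric Laplace density. -/
lemma map_exp_gaussian_mixture_eq_withDensity_alDensity (m : ℝ) {σ τ : ℝ}
    (hτ : τ ∈ Set.Ioo (0 : ℝ) 1) (hσ : 0 < σ) :
    (((expMeasure 1).prod (gaussianReal 0 1)).map
      fun p ↦ m + p.1 * (σ * ((1 - 2 * τ) / (τ * (1 - τ)))) +
        Real.sqrt p.1 * (σ * Real.sqrt (2 / (τ * (1 - τ))) * p.2)) =
      volume.withDensity fun y ↦ ENNReal.ofReal (alDensity m σ τ y) := by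
  have := isProbabilityMeasure_expMeasure one_pos
  have := isFiniteMeasure_withDensity_ofReal (integrable_alDensity m hτ hσ).2
  refine Measure.ext_of_charFun (funext fun t ↦ ?_)
  rw [charFun_map_exp_gaussian_mixture, charFun_withDensity_alDensity m hτ hσ]
  have hτ₀ := hτ.1
  have hτ₁ := sub_pos.mpr hτ.2
  have hc₀ : (τ : ℂ) ≠ 0 := mod_cast hτ₀.ne'
  have hc₁ : (1 : ℂ) - τ ≠ 0 := mod_cast hτ₁.ne'
  have hs : (Real.sqrt (2 / (τ * (1 - τ))) : ℂ) ^ 2 = 2 / (τ * (1 - τ)) := by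
    rw [← Complex.ofReal_pow, Real.sq_sqrt (by positivity)]
    push_cast
    rfl
  have key : (1 : ℂ) - (t * (σ * ((1 - 2 * τ) / (τ * (1 - τ))) : ℝ) * Complex.I -
      (t * (σ * Real.sqrt (2 / (τ * (1 - τ))) : ℝ)) ^ 2 / 2) =
      (1 - τ + σ * t * Complex.I) * (τ - σ * t * Complex.I) / (τ * (1 - τ)) := by
    push_cast
    rw [mul_pow, mul_pow, hs]
    field_simp
    linear_combination (σ * t : ℂ) ^ 2 * Complex.I_sq
  rw [key, div_div_eq_mul_div]
  ring

/-- Proposition 1 (marginal claim): for the Gaussian location–scale mixture representation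
`Y = μ + W·Dθ₁ + √W·DΘ₂LZ` of the multivariate asymmetric Laplace distribution, with
`W ~ Exp(1)`, `Z` an i.i.d. standard Gaussian vector independent of `W`, `LLᵀ = Ψ` a
correlation matrix, each coordinate `Y_i` has the univariate asymmetric Laplace density
`f_AL(·; μ_i, δ_i, τ_i)`. -/
theorem mal_marginal_is_al (n : ℕ) (hn : 1 ≤ n) (τ δ μ : Fin n → ℝ)
    (hτ : ∀ i, τ i ∈ Set.Ioo (0 : ℝ) 1) (hδ : ∀ i, 0 < δ i)
    (Ψ L : Matrix (Fin n) (Fin n) ℝ) (hΨ : Ψ.PosDef) (hdiag : ∀ i, Ψ i i = 1)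
    (hL : L * L.transpose = Ψ) (i : Fin n) (A : Set ℝ) (hA : MeasurableSet A) :
    (((expMeasure 1).prod (Measure.pi fun _ : Fin n => gaussianReal 0 1))
        {p : ℝ × (Fin n → ℝ) |
          μ i + p.1 * (δ i * ((1 - 2 * τ i) / (τ i * (1 - τ i)))) +
            Real.sqrt p.1 *
              (δ i * Real.sqrt (2 / (τ i * (1 - τ i))) * ∑ j, L i j * p.2 j) ∈ A}).toReal
      = ∫ y in A, alDensity (μ i) (δ i) (τ i) y := by
  have := isProbabilityMeasure_expMeasure one_pos
  have hsum : ∑ j, L i j ^ 2 = (1 : NNReal) := by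
    rw [NNReal.coe_one, ← hdiag i, ← hL, Matrix.mul_apply]
    simp [sq]
  have hmap : (expMeasure 1).prod (gaussianReal 0 1) =
      ((expMeasure 1).prod (Measure.pi fun _ : Fin n ↦ gaussianReal 0 1)).map
        (Prod.map id fun z ↦ ∑ j, L i j * z j) := by
    rw [← Measure.map_prod_map _ _ measurable_id (by fun_prop), Measure.map_id,
      map_sum_mul_pi_gaussianReal (L i) 1 hsum]
  have h := map_exp_gaussian_mixture_eq_withDensity_alDensity (μ i) (hτ i) (hδ i)
  rw [hmap, Measure.map_map (by fun_prop) (by fun_prop)] at h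
  rw [integral_eq_lintegral_of_nonneg_ae (ae_of_all _ (alDensity_nonneg (μ i) (hτ i) (hδ i)))
    (measurable_alDensity _ _ _).aestronglyMeasurable, ← withDensity_apply _ hA, ← h,
    Measure.map_apply (by fun_prop) hA]
  rfl
end
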